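/- Let N ≥ 1 and let μ be a probability distribution on ZMod N such that |μ̂(k)| < 1 for every k ∈ ZMod N with k ≠ 0. Then the Shannon entropy of the n-fold convolution powers converges to its maximal value: H(μ^{⋆n}) → log₂ N as n → ∞. -/

import Mathlib

open Filter

/-- Convolution of two functions on the cycle group `ZMod N`. -/
noncomputable def cycleConv {N : ℕ} [NeZero N] (μ ν : ZMod N → ℝ) : ZMod N → ℝ :=
  fun x => ∑ y : ZMod N, μ (x - y) * ν y

/-- `n`-fold convolution power of `μ` (with `μ^{⋆0} = δ₀`, so `μ^{⋆1} = μ`). -/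
noncomputable def cycleConvPow {N : ℕ} [NeZero N] (μ : ZMod N → ℝ) : ℕ → ZMod N → ℝ
  | 0 => fun x => if x = 0 then 1 else 0
  | n + 1 => cycleConv μ (cycleConvPow μ n)

/-- Fourier coefficient of `μ : ZMod N → ℝ`:
`μ̂(k) = ∑ s, μ(s) · exp(−2πi · k.val · s.val / N)`. -/
noncomputable def cycleFourier {N : ℕ} [NeZero N] (μ : ZMod N → ℝ) (k : ZMod N) : ℂ :=
  ∑ s : ZMod N, (μ s : ℂ) *
    Complex.exp (-(2 * (Real.pi : ℂ) * Complex.I * (k.val : ℂ) * (s.val : ℂ)) / (N : ℂ))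

/-- Shannon entropy (base 2) of a distribution on `ZMod N`, with `0 · log₂ 0 = 0`
(automatic since `Real.logb 2 0 = 0`). -/
noncomputable def shannonEntropy {N : ℕ} [NeZero N] (p : ZMod N → ℝ) : ℝ :=
  -∑ x : ZMod N, p x * Real.logb 2 (p x)

open scoped ZMod in
lemma cycleFourier_eq_dft {N : ℕ} [NeZero N] (μ : ZMod N → ℝ) (k : ZMod N) :
    cycleFourier μ k = 𝓕 (fun x => (μ x : ℂ)) k := by
  rw [ZMod.dft_apply, cycleFourier]
  refine Finset.sum_congr rfl fun s _ => ?_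
  have h : -(s * k) = ((-((k.val : ℤ) * (s.val : ℤ)) : ℤ) : ZMod N) := by
    push_cast
    rw [ZMod.natCast_zmod_val, ZMod.natCast_zmod_val, mul_comm]
  rw [h, ZMod.stdAddChar_coe, smul_eq_mul, mul_comm]
  congr 2
  push_cast
  ring

/-- The Fourier transform turns convolution into pointwise multiplication. -/
lemma cycleFourier_cycleConv {N : ℕ} [NeZero N] (μ ν : ZMod N → ℝ) (k : ZMod N) :
    cycleFourier (cycleConv μ ν) k = cycleFourier μ k * cycleFourier ν k := by
  simp only [cycleFourier_eq_dft, ZMod.dft_apply, cycleConv, smul_eq_mul]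
  push_cast
  simp_rw [Finset.mul_sum]
  rw [Finset.sum_comm]
  refine Finset.sum_congr rfl fun y _ => ?_
  rw [← Equiv.sum_comp (Equiv.addRight y), Finset.sum_mul]
  refine Finset.sum_congr rfl fun x _ => ?_
  have h : -((x + y) * k) = -(x * k) + -(y * k) := by ring
  simp only [Equiv.coe_addRight, add_sub_cancel_right]
  rw [h, AddChar.map_add_eq_mul]
  ring

lemma cycleFourier_cycleConvPow {N : ℕ} [NeZero N] (μ : ZMod N → ℝ) (n : ℕ) (k : ZMod N) :
    cycleFourier (cycleConvPow μ n) k = cycleFourier μ k ^ n := by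
  induction n with
  | zero => simp [cycleFourier, cycleConvPow, apply_ite Complex.ofReal]
  | succ n ih => rw [cycleConvPow, cycleFourier_cycleConv, ih, pow_succ']

/-- Fourier inversion on the cycle group. -/
lemma ofReal_eq_sum_cycleFourier {N : ℕ} [NeZero N] (μ : ZMod N → ℝ) (x : ZMod N) :
    (μ x : ℂ) = (N : ℂ)⁻¹ * ∑ k, ZMod.stdAddChar (k * x) * cycleFourier μ k := by
  simp only [cycleFourier_eq_dft]
  have h := congrFun (ZMod.dft.symm_apply_apply (fun x => (μ x : ℂ))) x
  rw [ZMod.invDFT_apply] at h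
  simpa only [smul_eq_mul] using h.symm

/-- The convolution powers converge pointwise to the uniform distribution. -/
lemma tendsto_cycleConvPow {N : ℕ} [NeZero N] (μ : ZMod N → ℝ)
    (hsum : ∑ x : ZMod N, μ x = 1)
    (hfourier : ∀ k : ZMod N, k ≠ 0 → ‖cycleFourier μ k‖ < 1) (x : ZMod N) :
    Tendsto (fun n : ℕ => cycleConvPow μ n x) atTop (nhds (N : ℝ)⁻¹) := by
  have hzero : cycleFourier μ 0 = 1 := by
    rw [cycleFourier_eq_dft, ZMod.dft_apply_zero]
    exact_mod_cast hsum
  have hlim : Tendsto (fun n : ℕ => (cycleConvPow μ n x : ℂ)) atTop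
      (nhds ((N : ℂ)⁻¹ * ∑ k, ZMod.stdAddChar (k * x) * if k = 0 then 1 else 0)) := by
    simp only [ofReal_eq_sum_cycleFourier (cycleConvPow μ _) x, cycleFourier_cycleConvPow]
    refine (tendsto_finsetSum _ fun k _ => Tendsto.const_mul _ ?_).const_mul _
    split_ifs with hk
    · rw [hk, hzero]
      exact tendsto_const_nhds.congr fun n => (one_pow n).symm
    · exact tendsto_pow_atTop_nhds_zero_of_norm_lt_one (hfourier k hk)
  rw [← Filter.tendsto_ofReal_iff]
  simpa using hlim

lemma continuous_shannonEntropy {N : ℕ} [NeZero N] :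
    Continuous (shannonEntropy : (ZMod N → ℝ) → ℝ) := by
  have h : Continuous fun t : ℝ => t * Real.logb 2 t := by
    simpa only [Real.logb, mul_div_assoc] using Real.continuous_mul_log.div_const (Real.log 2)
  exact (continuous_finsetSum _ fun x _ => h.comp (continuous_apply x)).neg

lemma shannonEntropy_uniform {N : ℕ} [NeZero N] :
    shannonEntropy (fun _ : ZMod N => (N : ℝ)⁻¹) = Real.logb 2 N := by
  have hN : (N : ℝ) ≠ 0 := NeZero.ne _
  simp [shannonEntropy, Real.logb_inv, ZMod.card, hN]

/-- If every nonzero Fourier coefficient of the probability distribution `μ` on `ZMod N`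
has modulus strictly less than 1, then the Shannon entropy of the convolution powers of `μ`
converges to its maximal value `log₂ N`. -/
theorem shannon_entropy_tendsto_logb_of_fourier_lt_one
    (N : ℕ) [NeZero N] (hN : 1 ≤ N) (μ : ZMod N → ℝ)
    (hpos : ∀ x, 0 ≤ μ x) (hsum : ∑ x : ZMod N, μ x = 1)
    (hfourier : ∀ k : ZMod N, k ≠ 0 → ‖cycleFourier μ k‖ < 1) :
    Tendsto (fun n : ℕ => shannonEntropy (cycleConvPow μ n)) atTop
      (nhds (Real.logb 2 (N : ℝ))) := by
  rw [← shannonEntropy_uniform]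
  exact (continuous_shannonEntropy.tendsto _).comp
    (tendsto_pi_nhds.2 (tendsto_cycleConvPow μ hsum hfourier))
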